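/- There is no function Ψ : (ℕ → ℕ → Bool) → (ℕ → ℕ) such that (i) for every relation code X coding a stable linear order on ℕ, the sequence Ψ X is ascending for X or descending for X, and (ii) Ψ is continuous at the point X₀ coding the usual order on ℕ. (This is the set-theoretic content of the paper's Corollary that the uniform stable ascending/descending sequence principle USADS is equivalent to arithmetical comprehension.) -/

import Mathlib

/-- `X` codes a linear order on `ℕ`. -/
def LinOrderCode (X : ℕ → ℕ → Bool) : Prop :=
  (∀ x, X x x = true) ∧
  (∀ x y z, X x y = true → X y z = true → X x z = true) ∧
  (∀ x y, X x y = true → X y x = true → x = y) ∧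
  (∀ x y, X x y = true ∨ X y x = true)

/-- `p` is an immediate `≤_X`-predecessor of `y`. -/
def ImmPred (X : ℕ → ℕ → Bool) (p y : ℕ) : Prop :=
  X p y = true ∧ p ≠ y ∧ ∀ z, X p z = true → X z y = true → z = p ∨ z = y

/-- The linear order coded by `X` is stable: every element other than the least one
has an immediate predecessor, every element other than the greatest one has an
immediate successor, and every element has finitely many predecessors or finitely
many successors. -/
def StableOrderCode (X : ℕ → ℕ → Bool) : Prop :=
  (∀ y, ¬ (∀ z, X y z = true) → ∃ p, ImmPred X p y) ∧
  (∀ y, ¬ (∀ z, X z y = true) → ∃ s, ImmPred X y s) ∧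
  (∀ y, {z | X z y = true ∧ z ≠ y}.Finite ∨ {z | X y z = true ∧ z ≠ y}.Finite)

/-- `x` is an ascending sequence for the order coded by `X`. -/
def Ascending (X : ℕ → ℕ → Bool) (x : ℕ → ℕ) : Prop :=
  ∀ n, X (x n) (x (n + 1)) = true ∧ x n ≠ x (n + 1)

/-- `x` is a descending sequence for the order coded by `X`. -/
def Descending (X : ℕ → ℕ → Bool) (x : ℕ → ℕ) : Prop :=
  ∀ n, X (x (n + 1)) (x n) = true ∧ x n ≠ x (n + 1)

open Filter Topology

/-- Position of `a` in the order `⋯ < N + 1 < N < 0 < 1 < ⋯ < N - 1`, as an integer. -/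
def flipRank (N a : ℕ) : ℤ := if a < N then a else N - 1 - a

/-- Code of the order `⋯ < N + 1 < N < 0 < 1 < ⋯ < N - 1`, of type `ω*`. -/
def flipCode (N a b : ℕ) : Bool := decide (flipRank N a ≤ flipRank N b)

theorem flipCode_eq_true {N a b : ℕ} :
    flipCode N a b = true ↔ flipRank N a ≤ flipRank N b := by
  simp [flipCode]

theorem flipRank_injective (N : ℕ) : Function.Injective (flipRank N) := by
  intro a b h
  unfold flipRank at h
  split_ifs at h <;> omega

theorem linOrderCode_flipCode (N : ℕ) : LinOrderCode (flipCode N) := by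
  simp only [LinOrderCode, flipCode_eq_true]
  exact ⟨fun _ => le_rfl, fun _ _ _ => le_trans,
    fun _ _ h h' => flipRank_injective N (le_antisymm h h'), fun _ _ => le_total _ _⟩

theorem immPred_flipCode {N p y : ℕ} (h : flipRank N y = flipRank N p + 1) :
    ImmPred (flipCode N) p y := by
  simp only [ImmPred, flipCode_eq_true]
  refine ⟨by omega, fun e => by subst e; omega, fun z hz hz' => ?_⟩
  rcases hz.eq_or_lt with e | hlt
  · exact Or.inl (flipRank_injective N e.symm)
  · exact Or.inr (flipRank_injective N (by omega))

theorem flipRank_lt (N : ℕ) (a : ℕ) : flipRank N a < N := by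
  unfold flipRank
  split_ifs <;> omega

theorem exists_flipRank_eq {N : ℕ} {k : ℤ} (hk : k < N) : ∃ a, flipRank N a = k := by
  rcases le_or_gt 0 k with h | h
  · exact ⟨k.toNat, by unfold flipRank; split_ifs <;> omega⟩
  · exact ⟨(N - 1 - k).toNat, by unfold flipRank; split_ifs <;> omega⟩

theorem stableOrderCode_flipCode (N : ℕ) : StableOrderCode (flipCode N) := by
  refine ⟨fun y _ => ?_, fun y hy => ?_, fun y => Or.inr ?_⟩
  · obtain ⟨p, hp⟩ := exists_flipRank_eq (N := N) (k := flipRank N y - 1)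
      (by have := flipRank_lt N y; omega)
    exact ⟨p, immPred_flipCode (by omega)⟩
  · simp only [flipCode_eq_true, not_forall, not_le] at hy
    obtain ⟨z, hz⟩ := hy
    obtain ⟨s, hs⟩ := exists_flipRank_eq (N := N) (k := flipRank N y + 1)
      (by have := flipRank_lt N z; omega)
    exact ⟨s, immPred_flipCode hs⟩
  · refine (Set.finite_Iic (max N y)).subset fun z hz => ?_
    have h := flipCode_eq_true.1 hz.1
    unfold flipRank at h
    rw [Set.mem_Iic]
    split_ifs at h <;> omega

theorem not_ascending_flipCode (N : ℕ) (x : ℕ → ℕ) :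
    ¬ Ascending (flipCode N) x := by
  intro hx
  have hgrow : ∀ n : ℕ, flipRank N (x 0) + n ≤ flipRank N (x n) := by
    intro n
    induction n with
    | zero => simp
    | succ n ih =>
      have hle := flipCode_eq_true.1 (hx n).1
      have hne := (flipRank_injective N).ne (hx n).2
      push_cast
      omega
  have h := hgrow (N - flipRank N (x 0)).toNat
  have := flipRank_lt N (x (N - flipRank N (x 0)).toNat)
  omega

theorem flipCode_of_lt {N a b : ℕ} (ha : a < N) (hb : b < N) :
    flipCode N a b = decide (a ≤ b) := by
  simp [flipCode, flipRank, ha, hb]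

theorem tendsto_flipCode :
    Tendsto flipCode atTop (𝓝 fun a b => decide (a ≤ b)) := by
  refine tendsto_pi_nhds.2 fun a => tendsto_pi_nhds.2 fun b => ?_
  refine tendsto_const_nhds.congr' ?_
  filter_upwards [eventually_gt_atTop a, eventually_gt_atTop b] with N ha hb
  exact (flipCode_of_lt ha hb).symm

theorem linOrderCode_natLE : LinOrderCode fun a b => decide (a ≤ b) := by
  simp only [LinOrderCode, decide_eq_true_eq]
  exact ⟨fun _ => le_rfl, fun _ _ _ => le_trans, fun _ _ => le_antisymm, le_total⟩

theorem stableOrderCode_natLE : StableOrderCode fun a b => decide (a ≤ b) := by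
  simp only [StableOrderCode, ImmPred, decide_eq_true_eq]
  refine ⟨fun y hy => ⟨y - 1, ?_⟩, fun y _ => ⟨y + 1, by omega, by omega, by omega⟩,
    fun y => Or.inl ((Set.finite_Iic y).subset fun z hz => hz.1)⟩
  have hy0 : y ≠ 0 := by
    rintro rfl
    exact hy Nat.zero_le
  exact ⟨by omega, by omega, by omega⟩

theorem not_descending_natLE (x : ℕ → ℕ) : ¬ Descending (fun a b => decide (a ≤ b)) x := by
  intro hx
  have hanti : StrictAnti x := strictAnti_nat_of_succ_lt fun n =>
    lt_of_le_of_ne (of_decide_eq_true (hx n).1) (hx n).2.symm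
  obtain ⟨n, hn⟩ := WellFounded.not_rel_apply_succ (r := (· < ·)) x
  exact hn (hanti n.lt_succ_self)

/-- There is no uniform SADS-functional that is continuous at the usual order on `ℕ`. -/
theorem no_continuous_uniform_SADS :
    ¬ ∃ Ψ : (ℕ → ℕ → Bool) → (ℕ → ℕ),
      (∀ X : ℕ → ℕ → Bool, LinOrderCode X → StableOrderCode X →
        Ascending X (Ψ X) ∨ Descending X (Ψ X)) ∧
      ContinuousAt Ψ (fun a b => decide (a ≤ b)) := by
  rintro ⟨Ψ, hΨ, hcont⟩
  have hasc := (hΨ _ linOrderCode_natLE stableOrderCode_natLE).resolve_right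
    (not_descending_natLE _)
  have hlim := tendsto_pi_nhds.1 (hcont.tendsto.comp tendsto_flipCode)
  have hev (i : ℕ) := tendsto_pure.1 (nhds_discrete ℕ ▸ hlim i)
  generalize Ψ (fun a b => decide (a ≤ b)) = x at hasc hev
  obtain ⟨N, h0, h1, hN0, hN1⟩ := ((hev 0).and <| (hev 1).and <|
    (eventually_gt_atTop (x 0)).and (eventually_gt_atTop (x 1))).exists
  have hdesc := (hΨ _ (linOrderCode_flipCode N) (stableOrderCode_flipCode N)).resolve_left
    (not_ascending_flipCode N _)
  have hle := (hdesc 0).1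
  simp only [Function.comp_apply] at h0 h1
  rw [zero_add, h0, h1, flipCode_of_lt hN1 hN0] at hle
  exact (hasc 0).2 (le_antisymm (of_decide_eq_true (hasc 0).1) (of_decide_eq_true hle))
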